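/- Let Λ be an artin algebra with radical J such that Jⁿ = 0 and the factor algebra Λ/J^{n−1} is representation-finite. Then Λ is torsionless-finite, and hence the representation dimension of Λ is at most 3. -/

import Mathlib

open CategoryTheory

universe u

section Defs
variable (Λ : Type u) [Ring Λ]

/-- A module is torsionless if it embeds into a finitely generated free
(equivalently, projective) module. -/
def Torsionless (N : Type u) [AddCommGroup N] [Module Λ N] : Prop :=
  ∃ (n : ℕ) (f : N →ₗ[Λ] (Fin n → Λ)), Function.Injective f

/-- A module is divisible if it is a quotient of a finitely generated injective module. -/
def Divisible (N : Type u) [AddCommGroup N] [Module Λ N] : Prop :=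
  ∃ (Q : ModuleCat.{u} Λ), Module.Finite Λ Q ∧ Module.Injective Λ Q ∧
    ∃ f : ↥Q →ₗ[Λ] N, Function.Surjective f

/-- An indecomposable module: nonzero, and the only idempotent endomorphisms are 0 and 1. -/
def Indec (N : Type u) [AddCommGroup N] [Module Λ N] : Prop :=
  Nontrivial N ∧ ∀ e : Module.End Λ N, e * e = e → e = 0 ∨ e = 1

/-- `N` belongs to `add M`: it is a direct summand of a finite direct sum of copies of `M`. -/
def InAdd (M : Type u) [AddCommGroup M] [Module Λ M]
    (N : Type u) [AddCommGroup N] [Module Λ N] : Prop :=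
  ∃ (n : ℕ) (i : N →ₗ[Λ] (Fin n → M)) (p : (Fin n → M) →ₗ[Λ] N),
    p.comp i = LinearMap.id

/-- `N` is cogenerated by `M`: it embeds into a finite direct sum of copies of `M`. -/
def CogenBy (M : Type u) [AddCommGroup M] [Module Λ M]
    (N : Type u) [AddCommGroup N] [Module Λ N] : Prop :=
  ∃ (n : ℕ) (f : N →ₗ[Λ] (Fin n → M)), Function.Injective f

/-- There are only finitely many isomorphism classes of indecomposable torsionless modules. -/
def TorsionlessFinite : Prop :=
  ∃ (n : ℕ) (L : Fin n → ModuleCat.{u} Λ),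
    ∀ N : ModuleCat.{u} Λ, Module.Finite Λ N → Torsionless Λ N → Indec Λ N →
      ∃ i, Nonempty (N ≃ₗ[Λ] L i)

/-- The algebra is representation-finite. -/
def RepFinite : Prop :=
  ∃ (n : ℕ) (L : Fin n → ModuleCat.{u} Λ),
    ∀ N : ModuleCat.{u} Λ, Module.Finite Λ N → Indec Λ N →
      ∃ i, Nonempty (N ≃ₗ[Λ] L i)

/-- `M` has a projective resolution of length at most `d` by finitely generated projectives. -/
def ProjDimLE : ℕ → ModuleCat.{u} Λ → Prop
  | 0, M => Module.Projective Λ M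
  | (d+1), M => ∃ (P : ModuleCat.{u} Λ) (f : ↥P →ₗ[Λ] ↥M),
      Module.Projective Λ P ∧ Module.Finite Λ P ∧ Function.Surjective f ∧
      ProjDimLE d (ModuleCat.of Λ ↥(LinearMap.ker f))

/-- The global dimension of `Λ` is at most `d`. -/
def GlobalDimLE (d : ℕ) : Prop :=
  ∀ M : ModuleCat.{u} Λ, Module.Finite Λ M → ProjDimLE Λ d M

/-- `M` is a generator-cogenerator: every finitely generated projective and every finitely
generated injective module lies in `add M`. -/
def IsGenCogen (M : Type u) [AddCommGroup M] [Module Λ M] : Prop :=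
  Module.Finite Λ M ∧
  (∀ P : ModuleCat.{u} Λ, Module.Finite Λ P → Module.Projective Λ P → InAdd Λ M ↥P) ∧
  (∀ Q : ModuleCat.{u} Λ, Module.Finite Λ Q → Module.Injective Λ Q → InAdd Λ M ↥Q)

/-- The representation dimension of `Λ` is at most `d`. -/
def RepDimLE (d : ℕ) : Prop :=
  ∃ M : ModuleCat.{u} Λ, IsGenCogen Λ ↥M ∧ GlobalDimLE (Module.End Λ ↥M) d

end Defs

section Indecomposable

variable {Λ : Type u} [Ring Λ]

theorem Indec.eq_bot_or_eq_bot_of_isCompl {N : Type u} [AddCommGroup N] [Module Λ N]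
    (hN : Indec Λ N) {p q : Submodule Λ N} (h : IsCompl p q) : p = ⊥ ∨ q = ⊥ := by
  rcases hN.2 _ (Submodule.isIdempotentElem_projection h) with h0 | h1
  · left
    rw [← Submodule.range_projection h, h0, LinearMap.range_zero]
  · right
    rw [← Submodule.ker_projection h, h1]
    exact LinearMap.ker_id

/-- Fitting's lemma for indecomposable modules of finite length. -/
theorem Indec.isNilpotent_or_bijective {N : Type u} [AddCommGroup N] [Module Λ N]
    [IsNoetherian Λ N] [IsArtinian Λ N] (hN : Indec Λ N) (f : Module.End Λ N) :
    IsNilpotent f ∨ Function.Bijective f := by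
  obtain ⟨m, hm⟩ := Filter.eventually_atTop.mp f.eventually_isCompl_ker_pow_range_pow
  have hc := hm (m + 1) (Nat.le_succ m)
  rcases hN.eq_bot_or_eq_bot_of_isCompl hc with h | h
  · right
    have hinj : Function.Injective f := by
      have := LinearMap.ker_eq_bot.mp h
      rw [pow_succ] at this
      exact Function.Injective.of_comp this
    exact ⟨hinj, IsArtinian.surjective_of_injective_endomorphism f hinj⟩
  · exact Or.inl ⟨m + 1, LinearMap.range_eq_bot.mp h⟩

theorem Indec.bijective_of_apply_eq {N : Type u} [AddCommGroup N] [Module Λ N]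
    [IsNoetherian Λ N] [IsArtinian Λ N] (hN : Indec Λ N) (f : Module.End Λ N) {x : N}
    (hx : x ≠ 0) (hfx : f x = x) : Function.Bijective f := by
  refine (hN.isNilpotent_or_bijective f).resolve_left ?_
  rintro ⟨m, hm⟩
  have : ∀ m : ℕ, (f ^ m) x = x := by
    intro m
    induction m with
    | zero => rfl
    | succ m ih => rw [pow_succ, Module.End.mul_apply, hfx, ih]
  exact hx (by rw [← this m, hm, LinearMap.zero_apply])

theorem Indec.bijective_or_bijective_of_add_eq_one {N : Type u} [AddCommGroup N] [Module Λ N]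
    [IsNoetherian Λ N] [IsArtinian Λ N] (hN : Indec Λ N) {f g : Module.End Λ N}
    (h : f + g = 1) : Function.Bijective f ∨ Function.Bijective g := by
  refine (hN.isNilpotent_or_bijective f).symm.imp_right fun hf => ?_
  rw [← Module.End.isUnit_iff, ← sub_eq_of_eq_add' h.symm]
  exact hf.isUnit_one_sub

/-- A nonzero retract of an indecomposable module is the whole module. -/
theorem Indec.nonempty_equiv_of_bijective_comp {N Y : Type u} [AddCommGroup N] [Module Λ N]
    [AddCommGroup Y] [Module Λ Y] [Nontrivial N] (hY : Indec Λ Y) (i : N →ₗ[Λ] Y)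
    (p : Y →ₗ[Λ] N) (h : Function.Bijective (p ∘ₗ i)) : Nonempty (N ≃ₗ[Λ] Y) := by
  let t := LinearEquiv.ofBijective (p ∘ₗ i) h
  have ht : ∀ x, t.symm (p (i x)) = x := fun x => t.symm_apply_apply x
  let e : Module.End Λ Y := i ∘ₗ t.symm.toLinearMap ∘ₗ p
  have he : e * e = e := by
    ext y
    simp [e, ht]
  have hinj : Function.Injective i := fun x y hxy => h.1 (by simp [hxy])
  rcases hY.2 e he with h0 | h1
  · obtain ⟨x, hx⟩ := exists_ne (0 : N)
    have : e (i x) = i x := by simp [e, ht]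
    rw [h0, LinearMap.zero_apply] at this
    exact absurd (hinj (by rw [← this, map_zero])) hx
  · refine ⟨LinearEquiv.ofBijective i ⟨hinj, fun y => ⟨t.symm (p y), ?_⟩⟩⟩
    exact LinearMap.congr_fun h1 y

theorem exists_isCompl_of_not_indec {N : Type u} [AddCommGroup N] [Module Λ N] [Nontrivial N]
    (h : ¬ Indec Λ N) : ∃ p q : Submodule Λ N, IsCompl p q ∧ p ≠ ⊤ ∧ q ≠ ⊤ := by
  simp only [Indec, not_and, not_forall, not_or] at h
  obtain ⟨e, he, h0, h1⟩ := h inferInstance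
  have hc : IsCompl e.range e.ker := LinearMap.IsIdempotentElem.isCompl he
  refine ⟨e.range, e.ker, hc, fun ht => h1 ?_, fun ht => h0 (LinearMap.ker_eq_top.mp ht)⟩
  ext x
  obtain ⟨y, rfl⟩ := LinearMap.range_eq_top.mp ht x
  exact LinearMap.congr_fun he y

/-- Induction on direct sum decompositions of modules of finite length. -/
theorem finite_length_induction [IsArtinianRing Λ]
    {P : ∀ (N : Type u) [AddCommGroup N] [Module Λ N], Prop}
    (zero : ∀ (N : Type u) [AddCommGroup N] [Module Λ N], Subsingleton N → P N)
    (indec : ∀ (N : Type u) [AddCommGroup N] [Module Λ N] [Module.Finite Λ N], Indec Λ N → P N)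
    (compl : ∀ (N : Type u) [AddCommGroup N] [Module Λ N] [Module.Finite Λ N]
      (p q : Submodule Λ N), IsCompl p q → P p → P q → P N)
    (N : Type u) [AddCommGroup N] [Module Λ N] [Module.Finite Λ N] : P N := by
  induction hl : Module.length Λ N using WellFoundedLT.induction generalizing N with
  | ind l ih =>
    rcases subsingleton_or_nontrivial N with hN | hN
    · exact zero N hN
    · by_cases hi : Indec Λ N
      · exact indec N hi
      · obtain ⟨p, q, hpq, hp, hq⟩ := exists_isCompl_of_not_indec hi
        exact compl N p q hpq (ih _ (hl ▸ Submodule.length_lt hp) p rfl)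
          (ih _ (hl ▸ Submodule.length_lt hq) q rfl)

end Indecomposable

section FiniteUpToIso

variable {Λ : Type u} [Ring Λ]

/-- The class `C` of modules contains only finitely many modules up to isomorphism. -/
def FiniteUpToIso (C : ModuleCat.{u} Λ → Prop) : Prop :=
  ∃ (n : ℕ) (L : Fin n → ModuleCat.{u} Λ), ∀ N : ModuleCat.{u} Λ, C N →
    ∃ i, Nonempty (N ≃ₗ[Λ] L i)

theorem FiniteUpToIso.mono {C D : ModuleCat.{u} Λ → Prop} (hD : FiniteUpToIso D)
    (h : ∀ N, C N → D N) : FiniteUpToIso C := by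
  obtain ⟨n, L, hL⟩ := hD
  exact ⟨n, L, fun N hN => hL N (h N hN)⟩

theorem FiniteUpToIso.of_finite {ι : Type*} [Finite ι] {C : ModuleCat.{u} Λ → Prop}
    (L : ι → ModuleCat.{u} Λ) (h : ∀ N, C N → ∃ i, Nonempty (N ≃ₗ[Λ] L i)) :
    FiniteUpToIso C := by
  refine ⟨Nat.card ι, L ∘ (Finite.equivFin ι).symm, fun N hN => ?_⟩
  obtain ⟨i, hi⟩ := h N hN
  exact ⟨Finite.equivFin ι i, by rwa [Function.comp_apply, Equiv.symm_apply_apply]⟩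

/-- A class of modules with a finite complete invariant is finite up to isomorphism. -/
theorem FiniteUpToIso.of_invariant {ι : Type*} [Finite ι] {C : ModuleCat.{u} Λ → Prop}
    (R : ModuleCat.{u} Λ → ι → Prop) (hR : ∀ N, C N → ∃ i, R N i)
    (h : ∀ N N' i, C N → C N' → R N i → R N' i → Nonempty (N ≃ₗ[Λ] N')) :
    FiniteUpToIso C := by
  classical
  let L : ι → ModuleCat.{u} Λ := fun i =>
    if hi : ∃ N, C N ∧ R N i then hi.choose else ModuleCat.of Λ PUnit
  refine FiniteUpToIso.of_finite L fun N hN => ?_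
  obtain ⟨i, hi⟩ := hR N hN
  have hex : ∃ N, C N ∧ R N i := ⟨N, hN, hi⟩
  refine ⟨i, ?_⟩
  have hL : L i = hex.choose := dif_pos hex
  rw [hL]
  exact h _ _ i hN hex.choose_spec.1 hi hex.choose_spec.2

theorem FiniteUpToIso.exists_family {C : ModuleCat.{u} Λ → Prop} (h : FiniteUpToIso C) :
    ∃ (ι : Type) (_ : Finite ι) (L : ι → ModuleCat.{u} Λ), (∀ i, C (L i)) ∧
      ∀ N, C N → ∃ i, Nonempty (N ≃ₗ[Λ] L i) := by
  obtain ⟨n, L, hL⟩ := h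
  refine ⟨{i : Fin n // ∃ N, C N ∧ Nonempty (N ≃ₗ[Λ] L i)}, inferInstance,
    fun i => i.2.choose, fun i => i.2.choose_spec.1, fun N hN => ?_⟩
  obtain ⟨i, ⟨e⟩⟩ := hL N hN
  let j : {i : Fin n // ∃ N, C N ∧ Nonempty (N ≃ₗ[Λ] L i)} := ⟨i, N, hN, ⟨e⟩⟩
  obtain ⟨e'⟩ := j.2.choose_spec.2
  exact ⟨j, ⟨e.trans e'.symm⟩⟩

theorem FiniteUpToIso.or {C D : ModuleCat.{u} Λ → Prop} (hC : FiniteUpToIso C)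
    (hD : FiniteUpToIso D) : FiniteUpToIso fun N => C N ∨ D N := by
  obtain ⟨n, L, hL⟩ := hC
  obtain ⟨m, L', hL'⟩ := hD
  refine FiniteUpToIso.of_finite (Sum.elim L L') fun N hN => ?_
  rcases hN with hN | hN
  · obtain ⟨i, hi⟩ := hL N hN
    exact ⟨.inl i, hi⟩
  · obtain ⟨i, hi⟩ := hL' N hN
    exact ⟨.inr i, hi⟩

/-- A module of finite length has only finitely many indecomposable direct summands. -/
theorem finiteUpToIso_indec_summand [IsArtinianRing Λ] (Y : Type u) [AddCommGroup Y] [Module Λ Y]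
    [Module.Finite Λ Y] :
    FiniteUpToIso fun N : ModuleCat.{u} Λ => Module.Finite Λ N ∧ Indec Λ N ∧
      ∃ (i : N →ₗ[Λ] Y) (p : Y →ₗ[Λ] N), Function.Bijective (p ∘ₗ i) := by
  refine finite_length_induction
    (P := fun Y [AddCommGroup Y] [Module Λ Y] => FiniteUpToIso fun N : ModuleCat.{u} Λ =>
      Module.Finite Λ N ∧ Indec Λ N ∧
        ∃ (i : N →ₗ[Λ] Y) (p : Y →ₗ[Λ] N), Function.Bijective (p ∘ₗ i)) ?_ ?_ ?_ Y
  · intro Y _ _ hY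
    refine FiniteUpToIso.of_finite (ι := Empty) Empty.elim ?_
    rintro N ⟨-, hN, i, p, h⟩
    obtain ⟨x, hx⟩ := @exists_ne _ hN.1 (0 : N)
    refine absurd (h.1 ?_) hx
    simp [Subsingleton.elim (i x) 0]
  · intro Y _ _ _ hY
    refine FiniteUpToIso.of_finite (ι := Unit) (fun _ => ModuleCat.of Λ Y) ?_
    rintro N ⟨-, hN, i, p, h⟩
    have := hN.1
    exact ⟨(), hY.nonempty_equiv_of_bijective_comp i p h⟩
  · intro Y _ _ _ p q hpq hp hq
    refine (hp.or hq).mono ?_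
    rintro N ⟨hfin, hN, i, r, h⟩
    let t := LinearEquiv.ofBijective (r ∘ₗ i) h
    have hsum : t.symm.toLinearMap ∘ₗ r ∘ₗ p.projection q hpq ∘ₗ i +
        t.symm.toLinearMap ∘ₗ r ∘ₗ q.projection p hpq.symm ∘ₗ i = (1 : Module.End Λ N) := by
      ext x
      have := Submodule.projection_add_projection_eq_self hpq (i x)
      simp only [LinearMap.add_apply, LinearMap.comp_apply, LinearEquiv.coe_coe, ← map_add, this]
      exact t.symm_apply_apply x
    rcases hN.bijective_or_bijective_of_add_eq_one hsum with hb | hb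
    · exact Or.inl ⟨hfin, hN, p.projectionOnto q hpq ∘ₗ i,
        t.symm.toLinearMap ∘ₗ r ∘ₗ p.subtype, hb⟩
    · exact Or.inr ⟨hfin, hN, q.projectionOnto p hpq.symm ∘ₗ i,
        t.symm.toLinearMap ∘ₗ r ∘ₗ q.subtype, hb⟩

end FiniteUpToIso

section InAdd

variable {Λ : Type u} [Ring Λ] {M : Type u} [AddCommGroup M] [Module Λ M]

/-- The linear map `f` factors through a finite direct sum of copies of `M`. -/
def FactorsThroughAdd (M : Type u) [AddCommGroup M] [Module Λ M] {X Y : Type u} [AddCommGroup X]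
    [Module Λ X] [AddCommGroup Y] [Module Λ Y] (f : X →ₗ[Λ] Y) : Prop :=
  ∃ (n : ℕ) (i : Fin n → X →ₗ[Λ] M) (p : Fin n → M →ₗ[Λ] Y), ∑ j, p j ∘ₗ i j = f

theorem FactorsThroughAdd.add {X Y : Type u} [AddCommGroup X]
    [Module Λ X] [AddCommGroup Y] [Module Λ Y] {f g : X →ₗ[Λ] Y} (hf : FactorsThroughAdd M f)
    (hg : FactorsThroughAdd M g) : FactorsThroughAdd M (f + g) := by
  obtain ⟨n, i, p, rfl⟩ := hf
  obtain ⟨m, i', p', rfl⟩ := hg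
  exact ⟨n + m, Fin.append i i', Fin.append p p', by simp [Fin.sum_univ_add]⟩

theorem FactorsThroughAdd.comp {X Y X' Y' : Type u} [AddCommGroup X]
    [Module Λ X] [AddCommGroup Y] [Module Λ Y] [AddCommGroup X']
    [Module Λ X'] [AddCommGroup Y'] [Module Λ Y'] {f : X →ₗ[Λ] Y} (hf : FactorsThroughAdd M f)
    (g : Y →ₗ[Λ] Y') (h : X' →ₗ[Λ] X) : FactorsThroughAdd M (g ∘ₗ f ∘ₗ h) := by
  obtain ⟨n, i, p, rfl⟩ := hf
  exact ⟨n, fun j => i j ∘ₗ h, fun j => g ∘ₗ p j, by ext; simp⟩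

theorem inAdd_iff {N : Type u} [AddCommGroup N] [Module Λ N] :
    InAdd Λ M N ↔ FactorsThroughAdd M (LinearMap.id : N →ₗ[Λ] N) := by
  constructor
  · rintro ⟨n, i, p, h⟩
    refine ⟨n, fun j => LinearMap.proj j ∘ₗ i, fun j => p ∘ₗ LinearMap.single Λ (fun _ => M) j, ?_⟩
    ext x
    rw [← h]
    simp [← map_sum, Finset.univ_sum_single]
  · rintro ⟨n, i, p, h⟩
    refine ⟨n, LinearMap.pi i, ∑ j, p j ∘ₗ LinearMap.proj j, ?_⟩
    rw [← h]
    ext x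
    simp

theorem InAdd.of_retract {N Y : Type u} [AddCommGroup N] [Module Λ N] [AddCommGroup Y]
    [Module Λ Y] (hY : InAdd Λ M Y) (i : N →ₗ[Λ] Y) (p : Y →ₗ[Λ] N)
    (h : p ∘ₗ i = LinearMap.id) : InAdd Λ M N := by
  rw [inAdd_iff] at hY ⊢
  simpa [h] using hY.comp p i

theorem InAdd.of_equiv {N Y : Type u} [AddCommGroup N] [Module Λ N] [AddCommGroup Y]
    [Module Λ Y] (hY : InAdd Λ M Y) (e : N ≃ₗ[Λ] Y) : InAdd Λ M N :=
  hY.of_retract e.toLinearMap e.symm.toLinearMap (by ext; simp)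

theorem inAdd_self : InAdd Λ M M :=
  inAdd_iff.mpr ⟨1, fun _ => LinearMap.id, fun _ => LinearMap.id, by simp⟩

theorem InAdd.of_isCompl {N : Type u} [AddCommGroup N] [Module Λ N] {p q : Submodule Λ N}
    (h : IsCompl p q) (hp : InAdd Λ M p) (hq : InAdd Λ M q) : InAdd Λ M N := by
  rw [inAdd_iff] at hp hq ⊢
  rw [← Submodule.projection_add_projection_eq_id h]
  exact (hp.comp p.subtype (p.projectionOnto q h)).add
    (hq.comp q.subtype (q.projectionOnto p h.symm))

theorem InAdd.prod {N N' : Type u} [AddCommGroup N] [Module Λ N] [AddCommGroup N'] [Module Λ N']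
    (hN : InAdd Λ M N) (hN' : InAdd Λ M N') : InAdd Λ M (N × N') := by
  rw [inAdd_iff] at hN hN' ⊢
  convert (hN.comp (LinearMap.inl Λ N N') (LinearMap.fst Λ N N')).add
    (hN'.comp (LinearMap.inr Λ N N') (LinearMap.snd Λ N N')) using 1
  ext <;> simp

/-- If `M` is a retract of `M'` then `add M` is contained in `add M'`. -/
theorem InAdd.of_retract_left {N M' : Type u} [AddCommGroup N] [Module Λ N] [AddCommGroup M']
    [Module Λ M'] (hN : InAdd Λ M N) (i : M →ₗ[Λ] M') (p : M' →ₗ[Λ] M)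
    (h : p ∘ₗ i = LinearMap.id) : InAdd Λ M' N := by
  rw [inAdd_iff] at hN ⊢
  obtain ⟨n, s, r, hsr⟩ := hN
  refine ⟨n, fun j => i ∘ₗ s j, fun j => r j ∘ₗ p, ?_⟩
  rw [← hsr]
  have h' : ∀ x, p (i x) = x := LinearMap.congr_fun h
  ext x
  simp [h']

/-- A class of modules closed under direct summands and containing only finitely many
indecomposables consists of the summands of direct sums of copies of a single module. -/
theorem FiniteUpToIso.exists_inAdd_pi [IsArtinianRing Λ] {C : ModuleCat.{u} Λ → Prop}
    (hC : FiniteUpToIso fun N => Module.Finite Λ N ∧ C N ∧ Indec Λ N)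
    (hsummand : ∀ (N : ModuleCat.{u} Λ) (p q : Submodule Λ N), IsCompl p q → C N →
      C (ModuleCat.of Λ p)) :
    ∃ (ι : Type) (_ : Finite ι) (K : ι → ModuleCat.{u} Λ),
      (∀ i, Module.Finite Λ (K i) ∧ C (K i)) ∧
        ∀ N : ModuleCat.{u} Λ, Module.Finite Λ N → C N → InAdd Λ (Π i, K i) N := by
  classical
  obtain ⟨ι, hι, K, hK, hN⟩ := hC.exists_family
  refine ⟨ι, hι, K, fun i => ⟨(hK i).1, (hK i).2.1⟩, fun N hfin => ?_⟩
  refine finite_length_induction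
    (P := fun N [AddCommGroup N] [Module Λ N] => C (ModuleCat.of Λ N) → InAdd Λ (Π i, K i) N)
    ?_ ?_ ?_ N
  · intro N _ _ _ _
    exact ⟨0, 0, 0, Subsingleton.elim _ _⟩
  · intro N _ _ hfin hind hCN
    obtain ⟨i, ⟨e⟩⟩ := hN (ModuleCat.of Λ N) ⟨hfin, hCN, hind⟩
    refine InAdd.of_retract (inAdd_self (M := Π i, K i))
      (LinearMap.single Λ (fun i => K i) i ∘ₗ e.toLinearMap)
      (e.symm.toLinearMap ∘ₗ LinearMap.proj i) ?_
    ext x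
    simp
  · intro N _ _ _ p q hpq hp hq hCN
    exact InAdd.of_isCompl hpq (hp (hsummand _ p q hpq hCN)) (hq (hsummand _ q p hpq.symm hCN))

end InAdd

section ArtinAlgebra

theorem isArtinianRing_of_finite_algebra (k : Type u) [CommRing k] [IsArtinianRing k] {Λ : Type u} [Ring Λ]
    [Algebra k Λ] [Module.Finite k Λ] : IsArtinianRing Λ := IsArtinianRing.of_finite k Λ

theorem isNoetherian_hom (k : Type u) [CommRing k] [IsArtinianRing k] {Λ : Type u} [Ring Λ]
    [Algebra k Λ] [Module.Finite k Λ]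
    (X Y : Type u) [AddCommGroup X] [Module Λ X] [Module.Finite Λ X]
    [AddCommGroup Y] [Module Λ Y] [Module.Finite Λ Y] [Module k Y] [IsScalarTower k Λ Y] :
    IsNoetherian k (X →ₗ[Λ] Y) := by
  have : Module.Finite k Y := Module.Finite.trans Λ Y
  obtain ⟨n, g, hg⟩ := Module.Finite.exists_fin' Λ X
  let ev : (X →ₗ[Λ] Y) →ₗ[k] (Fin n → Y) :=
    { toFun := fun f j => f (g (Pi.single j 1))
      map_add' := fun _ _ => rfl
      map_smul' := fun _ _ => rfl }
  refine isNoetherian_of_injective ev fun f f' hff' => ?_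
  have : f ∘ₗ g = f' ∘ₗ g := LinearMap.pi_ext' fun j => LinearMap.ext_ring (congr_fun hff' j)
  ext x
  obtain ⟨y, rfl⟩ := hg x
  exact LinearMap.congr_fun this y

theorem exists_hom_generators (k : Type u) [CommRing k] [IsArtinianRing k] {Λ : Type u} [Ring Λ]
    [Algebra k Λ] [Module.Finite k Λ]
    (X Y : Type u) [AddCommGroup X] [Module Λ X] [Module.Finite Λ X]
    [AddCommGroup Y] [Module Λ Y] [Module.Finite Λ Y] :
    ∃ (r : ℕ) (f : Fin r → X →ₗ[Λ] Y), ∀ h : X →ₗ[Λ] Y, ∃ c : Fin r → Module.End Λ Y,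
      ∑ j, c j ∘ₗ f j = h := by
  let _ : Module k Y := Module.compHom Y (algebraMap k Λ)
  have : IsScalarTower k Λ Y := IsScalarTower.of_algebraMap_smul fun _ _ => rfl
  have : IsNoetherian k (X →ₗ[Λ] Y) := isNoetherian_hom k X Y
  obtain ⟨r, g, hg⟩ := Module.Finite.exists_fin' k (X →ₗ[Λ] Y)
  refine ⟨r, fun j => g (Pi.single j 1), fun h => ?_⟩
  obtain ⟨v, rfl⟩ := hg h
  refine ⟨fun j => v j • LinearMap.id, ?_⟩
  have hv : g v = ∑ j, v j • g (Pi.single j 1) := by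
    conv_lhs => rw [pi_eq_sum_univ' v, map_sum]
    exact Finset.sum_congr rfl fun j _ => g.map_smul _ _
  rw [hv]
  ext x
  simp

theorem isNoetherianRing_end (k : Type u) [CommRing k] [IsArtinianRing k] {Λ : Type u} [Ring Λ]
    [Algebra k Λ] [Module.Finite k Λ]
    (M : Type u) [AddCommGroup M] [Module Λ M] [Module.Finite Λ M] :
    IsNoetherianRing (Module.End Λ M) := by
  let _ : Module k M := Module.compHom M (algebraMap k Λ)
  have : IsScalarTower k Λ M := IsScalarTower.of_algebraMap_smul fun _ _ => rfl
  have : IsNoetherian k (Module.End Λ M) := isNoetherian_hom k M M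
  exact isNoetherian_of_tower k inferInstance

end ArtinAlgebra

section EndomorphismRing

variable {Λ : Type u} [Ring Λ] {M : Type u} [AddCommGroup M] [Module Λ M]

theorem InAdd.finite_projective_hom {N : Type u} [AddCommGroup N] [Module Λ N]
    (hN : InAdd Λ M N) : Module.Finite (Module.End Λ M) (N →ₗ[Λ] M) ∧
      Module.Projective (Module.End Λ M) (N →ₗ[Λ] M) := by
  obtain ⟨n, i, p, h⟩ := inAdd_iff.mp hN
  let s : (N →ₗ[Λ] M) →ₗ[Module.End Λ M] (Fin n → Module.End Λ M) :=
    { toFun := fun f j => f ∘ₗ p j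
      map_add' := fun _ _ => rfl
      map_smul' := fun _ _ => rfl }
  let t : (Fin n → Module.End Λ M) →ₗ[Module.End Λ M] (N →ₗ[Λ] M) :=
    { toFun := fun v => ∑ j, v j ∘ₗ i j
      map_add' := fun v w => by ext; simp [Finset.sum_add_distrib]
      map_smul' := fun c v => by ext; simp }
  have hts : t ∘ₗ s = LinearMap.id := by
    ext f x
    have := LinearMap.congr_fun h x
    simp only [LinearMap.sum_apply, LinearMap.comp_apply, LinearMap.id_apply] at this
    simp [t, s, ← map_sum, this]
  exact ⟨Module.Finite.of_surjective t fun f => ⟨s f, LinearMap.congr_fun hts f⟩,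
    Module.Projective.of_split s t hts⟩

/-- If every finitely generated module `X` has a left `add M`-approximation `X → M₀` with cokernel
in `add M`, then the endomorphism ring of `M` has global dimension at most three. -/
theorem globalDimLE_three_of_approximation [Module.Finite Λ M]
    [IsNoetherianRing (Module.End Λ M)]
    (happrox : ∀ X : ModuleCat.{u} Λ, Module.Finite Λ X → ∃ (M₀ : ModuleCat.{u} Λ)
      (φ : X →ₗ[Λ] M₀), InAdd Λ M M₀ ∧ InAdd Λ M (M₀ ⧸ LinearMap.range φ) ∧
        ∀ h : X →ₗ[Λ] M, ∃ h' : M₀ →ₗ[Λ] M, h' ∘ₗ φ = h) :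
    GlobalDimLE (Module.End Λ M) 3 := by
  intro F hF
  obtain ⟨a, f, hf⟩ := Module.Finite.exists_fin' (Module.End Λ M) F
  obtain ⟨b, g, hg⟩ := Module.Finite.exists_fin' (Module.End Λ M) (LinearMap.ker f)
  let G : (Fin a → M) →ₗ[Λ] (Fin b → M) :=
    ∑ j, LinearMap.pi fun i => (g (Pi.single i 1)).1 j ∘ₗ LinearMap.proj j
  let X := ModuleCat.of Λ ((Fin b → M) ⧸ LinearMap.range G)
  obtain ⟨M₀, φ, hM₀, hcok, hext⟩ := happrox X inferInstance
  let ι (i : Fin b) : M →ₗ[Λ] X :=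
    (LinearMap.range G).mkQ ∘ₗ LinearMap.single Λ (fun _ => M) i
  have hι (x : Fin b → M) : (LinearMap.range G).mkQ x = ∑ i, ι i (x i) := by
    simp only [ι, LinearMap.comp_apply, ← map_sum, LinearMap.coe_single, Finset.univ_sum_single]
  have hgval (v : Fin b → Module.End Λ M) (j : Fin a) :
      (g v).1 j = ∑ i, v i ∘ₗ (g (Pi.single i 1)).1 j := by
    conv_lhs => rw [pi_eq_sum_univ' v, map_sum]
    simp [Module.End.mul_eq_comp]
  have hG (x : Fin a → M) (i : Fin b) : G x i = ∑ j, (g (Pi.single i 1)).1 j (x j) := by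
    simp [G]
  have hιG (j : Fin a) : ∑ i, ι i ∘ₗ (g (Pi.single i 1)).1 j = 0 := by
    ext m
    have h0 : (LinearMap.range G).mkQ (G (Pi.single j m)) = 0 := by simp
    rw [hι] at h0
    have hGs (i : Fin b) : G (Pi.single j m) i = (g (Pi.single i 1)).1 j m := by
      rw [hG, Finset.sum_eq_single j (fun l _ hl => by simp [Pi.single_eq_of_ne hl]) (by simp),
        Pi.single_eq_same]
    simpa [hGs] using h0
  let θ : (M₀ →ₗ[Λ] M) →ₗ[Module.End Λ M] LinearMap.ker g :=
    { toFun := fun h => ⟨fun i => h ∘ₗ φ ∘ₗ ι i, by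
        rw [LinearMap.mem_ker, Subtype.ext_iff]
        funext j
        rw [hgval]
        ext m
        have := LinearMap.congr_fun (hιG j) m
        simp only [LinearMap.sum_apply, LinearMap.comp_apply, LinearMap.zero_apply] at this
        simp [← map_sum, this]⟩
      map_add' := fun _ _ => rfl
      map_smul' := fun _ _ => rfl }
  have hθ : Function.Surjective θ := by
    rintro ⟨v, hv⟩
    let w : (Fin b → M) →ₗ[Λ] M := ∑ i, v i ∘ₗ LinearMap.proj i
    have hw : LinearMap.range G ≤ LinearMap.ker w := by
      rintro _ ⟨x, rfl⟩
      have hv0 (j : Fin a) : ∑ i, v i ∘ₗ (g (Pi.single i 1)).1 j = 0 := by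
        rw [← hgval, LinearMap.mem_ker.mp hv]; rfl
      have hv1 (j : Fin a) : ∑ i, v i ((g (Pi.single i 1)).1 j (x j)) = 0 := by
        simpa using LinearMap.congr_fun (hv0 j) (x j)
      simp only [LinearMap.mem_ker, w, LinearMap.sum_apply, LinearMap.comp_apply,
        LinearMap.proj_apply, hG, map_sum]
      rw [Finset.sum_comm]
      exact Finset.sum_eq_zero fun j _ => hv1 j
    obtain ⟨h', hh'⟩ := hext ((LinearMap.range G).liftQ w hw)
    refine ⟨h', Subtype.ext (funext fun i => ?_)⟩
    change h' ∘ₗ φ ∘ₗ ι i = v i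
    rw [← LinearMap.comp_assoc, hh']
    ext m
    change w (Pi.single i m) = v i m
    simp only [w, LinearMap.sum_apply, LinearMap.comp_apply, LinearMap.proj_apply]
    rw [Finset.sum_eq_single i (fun l _ hl => by simp [Pi.single_eq_of_ne hl]) (by simp),
      Pi.single_eq_same]
  have hproj (n : ℕ) : Module.Projective (Module.End Λ M) (Fin n → Module.End Λ M) := inferInstance
  have hfin (n : ℕ) : Module.Finite (Module.End Λ M) (Fin n → Module.End Λ M) := inferInstance
  refine ⟨ModuleCat.of _ (Fin a → Module.End Λ M), f, hproj a, hfin a, hf,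
    ModuleCat.of _ (Fin b → Module.End Λ M), g, hproj b, hfin b, hg,
    ModuleCat.of _ (M₀ →ₗ[Λ] M), θ, hM₀.finite_projective_hom.2, hM₀.finite_projective_hom.1,
    hθ, ?_⟩
  have hker (h : M₀ →ₗ[Λ] M) : h ∈ LinearMap.ker θ ↔ LinearMap.range φ ≤ LinearMap.ker h := by
    rw [LinearMap.mem_ker, Subtype.ext_iff]
    constructor
    · rintro hh _ ⟨x, rfl⟩
      obtain ⟨y, rfl⟩ := (LinearMap.range G).mkQ_surjective x
      rw [hι, LinearMap.mem_ker, map_sum, map_sum]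
      exact Finset.sum_eq_zero fun i _ => LinearMap.congr_fun (congr_fun hh i) (y i)
    · intro hh
      funext i
      ext m
      exact hh ⟨ι i m, rfl⟩
  let e : LinearMap.ker θ →ₗ[Module.End Λ M] ((M₀ ⧸ LinearMap.range φ) →ₗ[Λ] M) :=
    { toFun := fun h => (LinearMap.range φ).liftQ h.1 ((hker _).mp h.2)
      map_add' := fun _ _ => by ext; rfl
      map_smul' := fun _ _ => by ext; rfl }
  let e' : ((M₀ ⧸ LinearMap.range φ) →ₗ[Λ] M) →ₗ[Module.End Λ M] LinearMap.ker θ :=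
    { toFun := fun h => ⟨h ∘ₗ (LinearMap.range φ).mkQ, (hker _).mpr fun x hx => by
        simp [(Submodule.Quotient.mk_eq_zero _).mpr hx]⟩
      map_add' := fun _ _ => rfl
      map_smul' := fun _ _ => rfl }
  have := hcok.finite_projective_hom.2
  exact Module.Projective.of_split e e' (by ext; rfl)

end EndomorphismRing

section RepresentationDimension

variable {Λ : Type u} [Ring Λ]

theorem Torsionless.of_injective {N N' : Type u} [AddCommGroup N] [Module Λ N] [AddCommGroup N']
    [Module Λ N'] (hN : Torsionless Λ N) (f : N' →ₗ[Λ] N) (hf : Function.Injective f) :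
    Torsionless Λ N' := by
  obtain ⟨n, g, hg⟩ := hN
  exact ⟨n, g ∘ₗ f, hg.comp hf⟩

theorem Torsionless.of_projective (P : Type u) [AddCommGroup P] [Module Λ P] [Module.Finite Λ P]
    [Module.Projective Λ P] : Torsionless Λ P := by
  obtain ⟨n, f, hf⟩ := Module.Finite.exists_fin' Λ P
  obtain ⟨g, hg⟩ := Module.projective_lifting_property f LinearMap.id hf
  exact ⟨n, g, Function.LeftInverse.injective (LinearMap.congr_fun hg)⟩

theorem Torsionless.exists_apply_ne_zero {N : Type u} [AddCommGroup N] [Module Λ N]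
    (hN : Torsionless Λ N) {x : N} (hx : x ≠ 0) : ∃ g : N →ₗ[Λ] Λ, g x ≠ 0 := by
  obtain ⟨n, f, hf⟩ := hN
  obtain ⟨j, hj⟩ := Function.ne_iff.mp ((map_ne_zero_iff f hf).mpr hx)
  exact ⟨LinearMap.proj j ∘ₗ f, hj⟩

theorem Divisible.of_surjective {N N' : Type u} [AddCommGroup N] [Module Λ N] [AddCommGroup N']
    [Module Λ N'] (hN : Divisible Λ N) (f : N →ₗ[Λ] N') (hf : Function.Surjective f) :
    Divisible Λ N' := by
  obtain ⟨Q, hfin, hinj, g, hg⟩ := hN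
  exact ⟨Q, hfin, hinj, f ∘ₗ g, hf.comp hg⟩

theorem Module.Injective.of_forall_pi {ι : Type} {Q : ι → Type u} [∀ i, AddCommGroup (Q i)]
    [∀ i, Module Λ (Q i)] (h : ∀ i, Module.Injective Λ (Q i)) :
    Module.Injective Λ (Π i, Q i) := by
  refine ⟨fun X Y _ _ _ _ f hf g => ?_⟩
  choose e he using fun i => (h i).out f hf (LinearMap.proj i ∘ₗ g)
  exact ⟨LinearMap.pi e, fun x => funext fun i => he i x⟩

theorem Divisible.pi {ι : Type} [Finite ι] {N : ι → Type u} [∀ i, AddCommGroup (N i)]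
    [∀ i, Module Λ (N i)] (h : ∀ i, Divisible Λ (N i)) : Divisible Λ (Π i, N i) := by
  choose Q hfin hinj g hg using h
  refine ⟨ModuleCat.of Λ (Π i, Q i), Module.Finite.pi, Module.Injective.of_forall_pi hinj,
    LinearMap.pi fun i => g i ∘ₗ LinearMap.proj i, fun x => ?_⟩
  choose y hy using fun i => hg i (x i)
  exact ⟨y, funext hy⟩

/-- If there are only finitely many indecomposable torsionless modules and only finitely many
indecomposable divisible modules, then the representation dimension is at most three. -/
theorem repDimLE_three_of_torsionless_of_divisible (k : Type u) [CommRing k] [IsArtinianRing k]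
    [Algebra k Λ] [Module.Finite k Λ]
    (hT : FiniteUpToIso fun N : ModuleCat.{u} Λ => Module.Finite Λ N ∧ Torsionless Λ N ∧ Indec Λ N)
    (hD : FiniteUpToIso fun N : ModuleCat.{u} Λ => Module.Finite Λ N ∧ Divisible Λ N ∧ Indec Λ N) :
    RepDimLE Λ 3 := by
  have : IsArtinianRing Λ := isArtinianRing_of_finite_algebra k
  obtain ⟨ι, _, K, hK, hKadd⟩ := hT.exists_inAdd_pi (C := fun N => Torsionless Λ N)
    fun N p q _ hN => hN.of_injective p.subtype p.injective_subtype
  obtain ⟨ι', _, L, hL, hLadd⟩ := hD.exists_inAdd_pi (C := fun N => Divisible Λ N)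
    fun N p q h hN => hN.of_surjective (p.projectionOnto q h)
      (Submodule.projectionOnto_surjective h)
  have hKfin i := (hK i).1
  have hLfin i := (hL i).1
  let KK := Π i, K i
  let LL := Π i, L i
  have hLL : Divisible Λ LL := Divisible.pi fun i => (hL i).2
  have hKM (N : ModuleCat.{u} Λ) (h1 : Module.Finite Λ N) (h2 : Torsionless Λ N) :
      InAdd Λ (KK × LL) N :=
    (hKadd N h1 h2).of_retract_left (LinearMap.inl Λ KK LL) (LinearMap.fst Λ KK LL)
      (LinearMap.fst_comp_inl ..)
  have hLM (N : ModuleCat.{u} Λ) (h1 : Module.Finite Λ N) (h2 : Divisible Λ N) :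
      InAdd Λ (KK × LL) N :=
    (hLadd N h1 h2).of_retract_left (LinearMap.inr Λ KK LL) (LinearMap.snd Λ KK LL)
      (LinearMap.snd_comp_inr ..)
  have : IsNoetherianRing (Module.End Λ (KK × LL)) := isNoetherianRing_end k _
  refine ⟨ModuleCat.of Λ (KK × LL), ⟨inferInstanceAs (Module.Finite Λ (KK × LL)),
    fun P h1 _ => hKM P h1 (Torsionless.of_projective P),
    fun Q h1 h2 => hLM Q h1 ⟨Q, h1, h2, LinearMap.id, Function.surjective_id⟩⟩,
    globalDimLE_three_of_approximation fun X hX => ?_⟩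
  obtain ⟨r, f, hf⟩ := exists_hom_generators (Λ := Λ) k X Λ
  obtain ⟨s, q, hq⟩ := exists_hom_generators (Λ := Λ) k X LL
  let F : X →ₗ[Λ] (Fin r → Λ) := LinearMap.pi f
  let T := X ⧸ LinearMap.ker F
  have hT : Torsionless Λ T := ⟨r, (LinearMap.ker F).liftQ F le_rfl,
    LinearMap.ker_eq_bot.mp (Submodule.ker_liftQ_eq_bot _ _ _ le_rfl)⟩
  have hLs : Divisible Λ (Fin s → LL) := Divisible.pi fun _ => hLL
  let φ : X →ₗ[Λ] T × (Fin s → LL) := (LinearMap.ker F).mkQ.prod (LinearMap.pi q)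
  refine ⟨ModuleCat.of Λ (T × (Fin s → LL)), φ, ?_, ?_, fun h => ?_⟩
  · exact (hKM (ModuleCat.of Λ T) (inferInstanceAs (Module.Finite Λ T)) hT).prod
      (hLM (ModuleCat.of Λ (Fin s → LL)) (inferInstanceAs (Module.Finite Λ (Fin s → LL))) hLs)
  · refine hLM (ModuleCat.of Λ ((T × (Fin s → LL)) ⧸ LinearMap.range φ))
      (inferInstanceAs (Module.Finite Λ ((T × (Fin s → LL)) ⧸ LinearMap.range φ)))
      (hLs.of_surjective ((LinearMap.range φ).mkQ ∘ₗ LinearMap.inr Λ T (Fin s → LL)) fun z => ?_)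
    obtain ⟨⟨t, d⟩, rfl⟩ := (LinearMap.range φ).mkQ_surjective z
    obtain ⟨x, rfl⟩ := (LinearMap.ker F).mkQ_surjective t
    refine ⟨d - LinearMap.pi q x, ?_⟩
    rw [LinearMap.comp_apply, ← sub_eq_zero, ← map_sub, ← LinearMap.mem_ker, Submodule.ker_mkQ]
    exact ⟨-x, by simp [φ]⟩
  · have hker : LinearMap.ker F ≤ LinearMap.ker (LinearMap.fst Λ KK LL ∘ₗ h) := by
      intro x hx
      by_contra hne
      obtain ⟨i, hi⟩ := Function.ne_iff.mp hne
      obtain ⟨g, hg⟩ := (hK i).2.exists_apply_ne_zero hi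
      obtain ⟨c, hc⟩ := hf (g ∘ₗ LinearMap.proj i ∘ₗ LinearMap.fst Λ KK LL ∘ₗ h)
      refine hg ((LinearMap.congr_fun hc x).symm.trans ?_)
      rw [LinearMap.sum_apply]
      refine Finset.sum_eq_zero fun j _ => ?_
      have hj : f j x = 0 := congr_fun (LinearMap.mem_ker.mp hx) j
      rw [LinearMap.comp_apply, hj, map_zero]
    obtain ⟨c, hc⟩ := hq (LinearMap.snd Λ KK LL ∘ₗ h)
    let h₂ : (Fin s → LL) →ₗ[Λ] LL := ∑ j, c j ∘ₗ LinearMap.proj j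
    refine ⟨((LinearMap.ker F).liftQ _ hker).prodMap h₂, ?_⟩
    refine LinearMap.ext fun x => Prod.ext rfl ?_
    rw [← LinearMap.snd_apply (R := Λ) (h x), ← LinearMap.comp_apply, ← hc]
    simp [φ, h₂]

end RepresentationDimension

section RepresentationFiniteQuotient

variable {Λ : Type u} [Ring Λ]

theorem finiteUpToIso_indec_of_repFinite_quotient (I : Ideal Λ) [I.IsTwoSided]
    (h : RepFinite (Λ ⧸ I)) :
    FiniteUpToIso fun N : ModuleCat.{u} Λ => Module.Finite Λ N ∧ Indec Λ N ∧
      ∀ r ∈ I, ∀ x : N, r • x = 0 := by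
  obtain ⟨n, L, hL⟩ := h
  let π := Ideal.Quotient.mk I
  refine ⟨n, fun i => (ModuleCat.restrictScalars π).obj (L i), fun N ⟨hfin, hind, hann⟩ => ?_⟩
  have htor : Module.IsTorsionBySet Λ N I := fun x r => hann r r.2 x
  let _ : Module (Λ ⧸ I) N := htor.module
  have hsmul (a : Λ) (x : N) : π a • x = a • x := rfl
  have : IsScalarTower Λ (Λ ⧸ I) N := htor.isScalarTower
  have hfin' : Module.Finite (Λ ⧸ I) N := Module.Finite.of_restrictScalars_finite Λ (Λ ⧸ I) N
  have hind' : Indec (Λ ⧸ I) N := by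
    refine ⟨hind.1, fun e he => ?_⟩
    let e' : Module.End Λ N := e.restrictScalars Λ
    rcases hind.2 e' (LinearMap.ext fun x => LinearMap.congr_fun he x) with h | h
    · exact Or.inl (LinearMap.ext fun x => LinearMap.congr_fun h x)
    · exact Or.inr (LinearMap.ext fun x => LinearMap.congr_fun h x)
  obtain ⟨i, ⟨e⟩⟩ := hL (ModuleCat.of (Λ ⧸ I) N) hfin' hind'
  exact ⟨i, ⟨{ e.toAddEquiv with map_smul' := fun a x => e.map_smul (π a) x }⟩⟩

/-- An indecomposable torsionless module which has a map to `Λ` not landing in the radical is a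
direct summand of `Λ`. -/
theorem Indec.summand_of_notMem_jacobson {N : Type u} [AddCommGroup N] [Module Λ N]
    [IsNoetherian Λ N] [IsArtinian Λ N] (hN : Indec Λ N) (g : N →ₗ[Λ] Λ) {x : N}
    (hx : g x ∉ (⊥ : Ideal Λ).jacobson) :
    ∃ (i : N →ₗ[Λ] Λ) (p : Λ →ₗ[Λ] N), Function.Bijective (p ∘ₗ i) := by
  by_contra! hno
  refine hx (Ideal.mem_jacobson_iff.mpr fun b => ?_)
  let p : Λ →ₗ[Λ] N := LinearMap.toSpanSingleton Λ N (b • x)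
  obtain ⟨m, hm⟩ := (hN.isNilpotent_or_bijective (p ∘ₗ g)).resolve_right (hno g p)
  have hpow (m : ℕ) : g (((p ∘ₗ g) ^ m) (b • x)) = (b * g x) ^ (m + 1) := by
    induction m with
    | zero => simp
    | succ m ih =>
      rw [pow_succ', Module.End.mul_apply, LinearMap.comp_apply, ih, pow_succ (b * g x) (m + 1)]
      simp [p]
  have hnil : IsNilpotent (b * g x) := ⟨m + 1, by rw [← hpow, hm]; simp⟩
  obtain ⟨z, hz⟩ := hnil.isUnit_add_one.exists_left_inv
  exact ⟨z, by rw [Ideal.mem_bot, ← hz]; noncomm_ring⟩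

theorem finiteUpToIso_torsionless_indec [IsArtinianRing Λ] (I : Ideal Λ) [I.IsTwoSided]
    (hI : ∀ r ∈ I, ∀ a ∈ (⊥ : Ideal Λ).jacobson, r * a = 0) (h : RepFinite (Λ ⧸ I)) :
    FiniteUpToIso fun N : ModuleCat.{u} Λ =>
      Module.Finite Λ N ∧ Torsionless Λ N ∧ Indec Λ N := by
  refine ((finiteUpToIso_indec_of_repFinite_quotient I h).or
    (finiteUpToIso_indec_summand Λ)).mono fun N ⟨hfin, htor, hind⟩ => ?_
  by_cases hJ : ∀ (g : N →ₗ[Λ] Λ) (x : N), g x ∈ (⊥ : Ideal Λ).jacobson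
  · refine Or.inl ⟨hfin, hind, fun r hr x => ?_⟩
    by_contra hne
    obtain ⟨g, hg⟩ := htor.exists_apply_ne_zero hne
    exact hg (by rw [map_smul, smul_eq_mul, hI r hr _ (hJ g x)])
  · push Not at hJ
    obtain ⟨g, x, hx⟩ := hJ
    exact Or.inr ⟨hfin, hind, hind.summand_of_notMem_jacobson g hx⟩

end RepresentationFiniteQuotient

section Divisible

variable {Λ : Type u} [Ring Λ]

theorem isSemisimpleModule_quotient_jacobson [IsArtinianRing Λ] :
    IsSemisimpleModule Λ (Λ ⧸ Ring.jacobson Λ) :=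
  (IsArtinian.isSemisimpleModule_iff_jacobson Λ _).mpr (Module.jacobson_quotient_jacobson Λ Λ)

theorem IsSimpleModule.indec (S : Type u) [AddCommGroup S] [Module Λ S] [IsSimpleModule Λ S] :
    Indec Λ S := by
  refine ⟨IsSimpleModule.nontrivial Λ S, fun e he => ?_⟩
  rcases LinearMap.bijective_or_eq_zero e with hb | h0
  · right
    ext x
    exact hb.1 (LinearMap.congr_fun he x)
  · exact Or.inl h0

theorem finiteUpToIso_isSimpleModule [IsArtinianRing Λ] :
    FiniteUpToIso fun S : ModuleCat.{u} Λ => IsSimpleModule Λ S := by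
  refine (finiteUpToIso_indec_summand (Λ ⧸ Ring.jacobson Λ)).mono fun S hS => ?_
  have : IsSemisimpleModule Λ (Λ ⧸ Ring.jacobson Λ) := isSemisimpleModule_quotient_jacobson
  obtain ⟨x, hx⟩ := @exists_ne _ (IsSimpleModule.nontrivial Λ S) (0 : S)
  have hsurj := IsSimpleModule.toSpanSingleton_surjective Λ hx
  have hJ : Ring.jacobson Λ ≤ LinearMap.ker (LinearMap.toSpanSingleton Λ S x) := by
    rw [← Submodule.comap_bot, ← IsSemisimpleModule.jacobson_eq_bot Λ S]
    exact Module.le_comap_jacobson _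
  obtain ⟨i, hi⟩ := IsSemisimpleModule.lifting_property
    ((Ring.jacobson Λ).liftQ (LinearMap.toSpanSingleton Λ S x) hJ)
    (fun y => (hsurj y).imp' (Ring.jacobson Λ).mkQ fun _ h => h) LinearMap.id
  exact ⟨Module.Finite.of_surjective _ hsurj, IsSimpleModule.indec S, i, _,
    by rw [hi]; exact Function.bijective_id⟩

theorem finiteUpToIso_injective_indec [IsArtinianRing Λ] :
    FiniteUpToIso fun N : ModuleCat.{u} Λ =>
      Module.Finite Λ N ∧ Module.Injective Λ N ∧ Indec Λ N := by
  obtain ⟨n, S, hS⟩ := finiteUpToIso_isSimpleModule (Λ := Λ)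
  refine FiniteUpToIso.of_invariant
    (fun N i => ∃ j : S i →ₗ[Λ] N, Function.Injective j ∧ Nontrivial (S i)) ?_ ?_
  · rintro N ⟨hfin, -, hind⟩
    have := hind.1
    obtain ⟨m, hm⟩ := IsAtomic.exists_atom (Submodule Λ N)
    have hm' : IsSimpleModule Λ m := isSimpleModule_iff_isAtom.mpr hm
    obtain ⟨i, ⟨e⟩⟩ := hS (ModuleCat.of Λ m) hm'
    have := IsSimpleModule.nontrivial Λ m
    exact ⟨i, m.subtype ∘ₗ e.symm.toLinearMap, m.injective_subtype.comp e.symm.injective,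
      e.symm.toEquiv.nontrivial⟩
  · rintro N N' i ⟨hfin, hinj, hind⟩ ⟨hfin', hinj', hind'⟩ ⟨j, hj, hnt⟩ ⟨j', hj', -⟩
    obtain ⟨a, ha⟩ := hinj'.out j hj j'
    obtain ⟨b, hb⟩ := hinj.out j' hj' j
    obtain ⟨x, hx⟩ := exists_ne (0 : S i)
    have := hind.1
    refine hind'.nonempty_equiv_of_bijective_comp a b
      (hind.bijective_of_apply_eq (b ∘ₗ a) ((map_ne_zero_iff j hj).mpr hx) ?_)
    rw [LinearMap.comp_apply, ha, hb]

theorem Module.Injective.of_bijective_comp {N Q : Type u} [AddCommGroup N] [Module Λ N]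
    [AddCommGroup Q] [Module Λ Q] (hQ : Module.Injective Λ Q) (i : N →ₗ[Λ] Q) (p : Q →ₗ[Λ] N)
    (h : Function.Bijective (p ∘ₗ i)) : Module.Injective Λ N := by
  refine ⟨fun X Y _ _ _ _ f hf g => ?_⟩
  obtain ⟨e, he⟩ := hQ.out f hf (i ∘ₗ g)
  let t := LinearEquiv.ofBijective (p ∘ₗ i) h
  refine ⟨t.symm.toLinearMap ∘ₗ p ∘ₗ e, fun x => ?_⟩
  rw [LinearMap.comp_apply, LinearMap.comp_apply, he]
  exact t.symm_apply_apply (g x)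

/-- An indecomposable quotient of an injective module `Q` in which some element of the socle of `Q`
survives is injective. -/
theorem Indec.injective_of_apply_ne_zero [IsArtinianRing Λ] {N Q : Type u} [AddCommGroup N]
    [Module Λ N] [Module.Finite Λ N] [AddCommGroup Q] [Module Λ Q] (hN : Indec Λ N)
    (hQ : Module.Injective Λ Q) (f : Q →ₗ[Λ] N) {s : Q} (hs : ∀ a ∈ Ring.jacobson Λ, a • s = 0)
    (hfs : f s ≠ 0) : Module.Injective Λ N := by
  have : IsSemisimpleModule Λ (Λ ⧸ Ring.jacobson Λ) := isSemisimpleModule_quotient_jacobson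
  let a : (Λ ⧸ Ring.jacobson Λ) →ₗ[Λ] Q :=
    (Ring.jacobson Λ).liftQ (LinearMap.toSpanSingleton Λ Q s) hs
  obtain ⟨c, hc⟩ := IsSemisimpleModule.lifting_property (f ∘ₗ a).rangeRestrict
    (f ∘ₗ a).surjective_rangeRestrict LinearMap.id
  obtain ⟨g, hg⟩ := hQ.out (LinearMap.range (f ∘ₗ a)).subtype (Submodule.injective_subtype _)
    (a ∘ₗ c)
  have hmem : f s ∈ LinearMap.range (f ∘ₗ a) := by
    refine ⟨(Ring.jacobson Λ).mkQ 1, congrArg f ?_⟩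
    exact (Submodule.liftQ_apply _ _ _).trans (one_smul Λ s)
  refine hQ.of_bijective_comp g f (hN.bijective_of_apply_eq (f ∘ₗ g) hfs ?_)
  have h1 : g (f s) = a (c ⟨f s, hmem⟩) := hg ⟨f s, hmem⟩
  have h2 := congrArg Subtype.val (LinearMap.congr_fun hc ⟨f s, hmem⟩)
  rw [LinearMap.comp_apply, h1]
  exact h2

theorem finiteUpToIso_divisible_indec [IsArtinianRing Λ] (I : Ideal Λ) [I.IsTwoSided]
    (hI : ∀ a ∈ (⊥ : Ideal Λ).jacobson, ∀ r ∈ I, a * r = 0) (h : RepFinite (Λ ⧸ I)) :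
    FiniteUpToIso fun N : ModuleCat.{u} Λ =>
      Module.Finite Λ N ∧ Divisible Λ N ∧ Indec Λ N := by
  refine ((finiteUpToIso_indec_of_repFinite_quotient I h).or
    finiteUpToIso_injective_indec).mono fun N ⟨hfin, ⟨Q, _, hQ, f, hf⟩, hind⟩ => ?_
  by_cases hann : ∀ r ∈ I, ∀ x : N, r • x = 0
  · exact Or.inl ⟨hfin, hind, hann⟩
  · push Not at hann
    obtain ⟨r, hr, x, hx⟩ := hann
    obtain ⟨q, rfl⟩ := hf x
    rw [← map_smul] at hx
    refine Or.inr ⟨hfin, hind.injective_of_apply_ne_zero hQ f (fun a ha => ?_) hx, hind⟩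
    rw [smul_smul, hI a (Ideal.jacobson_bot (R := Λ) ▸ ha) r hr, zero_smul]

end Divisible

section RadicalPower

variable {Λ : Type u} [Ring Λ]

/-- The left ideal spanned by all products of `m` elements of the ideal `J`. -/
def spanProducts (J : Ideal Λ) (m : ℕ) : Ideal Λ :=
  Submodule.span Λ {x : Λ | ∃ b : Fin m → Λ, (∀ i, b i ∈ J) ∧ x = (List.ofFn b).prod}

theorem prod_ofFn_snoc {m : ℕ} (b : Fin m → Λ) (a : Λ) :
    (List.ofFn (Fin.snoc b a : Fin (m + 1) → Λ)).prod = (List.ofFn b).prod * a := by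
  rw [List.ofFn_succ']
  simp [-List.ofFn_succ]

theorem spanProducts_isTwoSided (J : Ideal Λ) [J.IsTwoSided] (m : ℕ) :
    (spanProducts J m).IsTwoSided := by
  refine ⟨fun {a} c ha => ?_⟩
  induction ha using Submodule.span_induction with
  | zero => rw [zero_mul]; exact zero_mem _
  | add x y _ _ hx hy => rw [add_mul]; exact add_mem hx hy
  | smul r x _ hx => rw [smul_mul_assoc]; exact Submodule.smul_mem _ r hx
  | mem x hx =>
    obtain ⟨b, hb, rfl⟩ := hx
    rcases m with _ | m
    · rw [List.ofFn_zero, List.prod_nil, one_mul, ← mul_one c]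
      exact Ideal.mul_mem_left _ c (Submodule.subset_span ⟨b, hb, by simp⟩)
    · refine Submodule.subset_span ⟨Fin.snoc (Fin.init b) (b (Fin.last m) * c),
        fun i => ?_, ?_⟩
      · refine Fin.lastCases ?_ (fun i => ?_) i
        · simpa using Ideal.mul_mem_right c J (hb _)
        · simpa [Fin.init] using hb _
      · rw [prod_ofFn_snoc, ← mul_assoc, ← prod_ofFn_snoc (Fin.init b), Fin.snoc_init_self]

variable {J : Ideal Λ} {m : ℕ}

theorem mul_eq_zero_of_mem_spanProducts
    (h : ∀ b : Fin (m + 1) → Λ, (∀ i, b i ∈ J) → (List.ofFn b).prod = 0) {r a : Λ}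
    (hr : r ∈ spanProducts J m) (ha : a ∈ J) : r * a = 0 := by
  induction hr using Submodule.span_induction with
  | zero => exact zero_mul a
  | add x y _ _ hx hy => rw [add_mul, hx, hy, add_zero]
  | smul r x _ hx => rw [smul_mul_assoc, hx, smul_zero]
  | mem x hx =>
    obtain ⟨b, hb, rfl⟩ := hx
    have := h (Fin.snoc b a) fun i => Fin.lastCases (by simpa) (fun i => by simpa using hb i) i
    rwa [prod_ofFn_snoc] at this

theorem mul_eq_zero_of_mem_of_mem_spanProducts [J.IsTwoSided]
    (h : ∀ b : Fin (m + 1) → Λ, (∀ i, b i ∈ J) → (List.ofFn b).prod = 0) {r a : Λ}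
    (ha : a ∈ J) (hr : r ∈ spanProducts J m) : a * r = 0 := by
  induction hr using Submodule.span_induction generalizing a with
  | zero => exact mul_zero a
  | add x y _ _ hx hy => rw [mul_add, hx ha, hy ha, add_zero]
  | smul r x _ hx => rw [smul_eq_mul, ← mul_assoc, hx (Ideal.mul_mem_right r J ha)]
  | mem x hx =>
    obtain ⟨b, hb, rfl⟩ := hx
    simpa [List.ofFn_succ] using
      h (Fin.cons a b) fun i => Fin.cases (by simpa) (fun i => by simpa using hb i) i

end RadicalPower

/-- If `Jⁿ = 0` and `Λ/J^{n-1}` is representation-finite, then `Λ` is torsionless-finite and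
hence has representation dimension at most 3.  The quotient `Λ/J^{n-1}` is formalized as any
surjective ring homomorphism image of `Λ` whose kernel is the (left-)span of all products of
`n-1` elements of the radical `J`. -/
theorem stmt9 (k : Type u) [CommRing k] [IsArtinianRing k]
    (Λ : Type u) [Ring Λ] [Algebra k Λ] [Module.Finite k Λ]
    (n : ℕ)
    (hJn : ∀ b : Fin n → Λ, (∀ i, b i ∈ (⊥ : Ideal Λ).jacobson) →
      (List.ofFn b).prod = 0)
    (hquot : ∀ (Λ' : Type u) [Ring Λ'] (π : Λ →+* Λ'), Function.Surjective π →
      (∀ a : Λ, π a = 0 ↔ a ∈ Submodule.span Λ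
        {x : Λ | ∃ b : Fin (n-1) → Λ, (∀ i, b i ∈ (⊥ : Ideal Λ).jacobson) ∧
          x = (List.ofFn b).prod}) →
      RepFinite Λ') :
    TorsionlessFinite Λ ∧ RepDimLE Λ 3 := by

  have : IsArtinianRing Λ := isArtinianRing_of_finite_algebra k
  have hfinite : (FiniteUpToIso fun N : ModuleCat.{u} Λ =>
      Module.Finite Λ N ∧ Torsionless Λ N ∧ Indec Λ N) ∧
      FiniteUpToIso fun N : ModuleCat.{u} Λ =>
        Module.Finite Λ N ∧ Divisible Λ N ∧ Indec Λ N := by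
    rcases n with _ | m
    · have : Subsingleton Λ := subsingleton_of_zero_eq_one (by simpa using (hJn 0 (by simp)).symm)
      have hno (N : ModuleCat.{u} Λ) (hN : Indec Λ N) : False :=
        not_subsingleton_iff_nontrivial.mpr hN.1 (Module.subsingleton Λ N)
      exact ⟨.of_finite (ι := Empty) Empty.elim fun N hN => (hno N hN.2.2).elim,
        .of_finite (ι := Empty) Empty.elim fun N hN => (hno N hN.2.2).elim⟩
    · let I := spanProducts (⊥ : Ideal Λ).jacobson m
      have : I.IsTwoSided := spanProducts_isTwoSided _ m
      have hrep : RepFinite (Λ ⧸ I) := hquot (Λ ⧸ I) (Ideal.Quotient.mk I)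
        Ideal.Quotient.mk_surjective fun a => Ideal.Quotient.eq_zero_iff_mem
      exact ⟨finiteUpToIso_torsionless_indec I
          (fun r hr a ha => mul_eq_zero_of_mem_spanProducts hJn hr ha) hrep,
        finiteUpToIso_divisible_indec I
          (fun a ha r hr => mul_eq_zero_of_mem_of_mem_spanProducts hJn ha hr) hrep⟩
  obtain ⟨n, L, hL⟩ := hfinite.1
  exact ⟨⟨n, L, fun N hfin htor hind => hL N ⟨hfin, htor, hind⟩⟩,
    repDimLE_three_of_torsionless_of_divisible k hfinite.1 hfinite.2⟩
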